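/- arXiv:2004.06156 — 9 statements merged into one kernel-verified Lean document; each statement's English description precedes it below -/
import Mathlib

section
/- Let p ≥ 1 and let x, s ∈ ℝ^{p+1} be linearly independent vectors. Then the function ℓ*(β) = log(⟨x, β⟩) − ⟨s, β⟩ is unbounded above on the set {β ∈ ℝ^{p+1} : ⟨x, β⟩ > 0}; that is, for every C ∈ ℝ there exists β ∈ ℝ^{p+1} with ⟨x, β⟩ > 0 and log(⟨x, β⟩) − ⟨s, β⟩ > C. -/
/-- The Gram determinant of two linearly independent real vectors is nonzero. -/
theorem gram_det_ne_zero_of_linearIndependent {ι : Type*} [Fintype ι] {x s : ι → ℝ}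
    (h : LinearIndependent ℝ ![x, s]) :
    (x ⬝ᵥ x) * (s ⬝ᵥ s) - (x ⬝ᵥ s) ^ 2 ≠ 0 := by
  intro hdet
  have hw : (-(x ⬝ᵥ s)) • x + (x ⬝ᵥ x) • s = 0 := by
    rw [← dotProduct_self_eq_zero]
    simp only [add_dotProduct, dotProduct_add, smul_dotProduct, dotProduct_smul, smul_eq_mul,
      dotProduct_comm s x]
    linear_combination (x ⬝ᵥ x) * hdet
  have hxx : x ⬝ᵥ x = 0 := (LinearIndependent.pair_iff.1 h _ _ hw).2
  exact h.ne_zero 0 (dotProduct_self_eq_zero.1 hxx)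

/-- Two linearly independent real vectors can be given any prescribed pair of dot products with
a common vector. -/
theorem exists_dotProduct_eq_of_linearIndependent {ι : Type*} [Fintype ι] {x s : ι → ℝ}
    (h : LinearIndependent ℝ ![x, s]) (a b : ℝ) :
    ∃ β : ι → ℝ, x ⬝ᵥ β = a ∧ s ⬝ᵥ β = b := by
  have hdet := gram_det_ne_zero_of_linearIndependent h
  refine ⟨((x ⬝ᵥ x) * (s ⬝ᵥ s) - (x ⬝ᵥ s) ^ 2)⁻¹ •
    ((a * (s ⬝ᵥ s) - b * (x ⬝ᵥ s)) • x + (b * (x ⬝ᵥ x) - a * (x ⬝ᵥ s)) • s), ?_, ?_⟩ <;>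
  · simp only [dotProduct_add, dotProduct_smul, smul_eq_mul, dotProduct_comm s x]
    rw [inv_mul_eq_iff_eq_mul₀ hdet]
    ring


/-- The per-event-time log-likelihood `ℓ*(β) = log⟨x, β⟩ − ⟨s, β⟩` of the additive
hazards model is unbounded above on `{β : ⟨x, β⟩ > 0}` whenever `x` and `s` are
linearly independent vectors in `ℝ^{p+1}`, `p ≥ 1`. -/
theorem loglik_unbounded (p : ℕ) (hp : 1 ≤ p) (x s : Fin (p + 1) → ℝ)
    (hind : LinearIndependent ℝ ![x, s]) :
    ∀ C : ℝ, ∃ β : Fin (p + 1) → ℝ,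
      0 < ∑ j, x j * β j ∧
      C < Real.log (∑ j, x j * β j) - ∑ j, s j * β j := by
  intro C
  obtain ⟨β, hx, hs⟩ := exists_dotProduct_eq_of_linearIndependent hind 1 (-(C + 1))
  rw [dotProduct] at hx hs
  refine ⟨β, ?_, ?_⟩
  · rw [hx]
    exact one_pos
  · rw [hx, hs, Real.log_one]
    linarith
end

section
/- Let p ≥ 1 and K ≥ 1. For each k = 1, …, K let x^{(k)} ∈ ℝ^{p+1} with x^{(k)}_0 = 1, and let s^{(k)} ∈ ℝ^{p+1}. If for at least one index k₀ the vectors x^{(k₀)} and s^{(k₀)} are linearly independent, then the total log-likelihood (β_1, …, β_K) ↦ Σ_{k=1}^K [ log(⟨x^{(k)}, β_k⟩) − ⟨s^{(k)}, β_k⟩ ] is unbounded above on the set of tuples (β_1, …, β_K) ∈ (ℝ^{p+1})^K satisfying ⟨x^{(k)}, β_k⟩ > 0 for all k. -/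
/-- Two linearly independent vectors are separated by a direction orthogonal to the first and
making a negative product with the second. -/
theorem exists_dotProduct_eq_zero_and_dotProduct_neg {ι : Type*} [Fintype ι] {x s : ι → ℝ}
    (h : LinearIndependent ℝ ![x, s]) : ∃ v : ι → ℝ, x ⬝ᵥ v = 0 ∧ s ⬝ᵥ v < 0 := by
  have hx : x ≠ 0 := h.ne_zero 0
  have hxx : 0 < x ⬝ᵥ x := by simpa using Matrix.dotProduct_star_self_pos_iff.2 hx
  set v : ι → ℝ := (x ⬝ᵥ s) • x - (x ⬝ᵥ x) • s with hv
  have hxv : x ⬝ᵥ v = 0 := by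
    simp only [hv, dotProduct_sub, dotProduct_smul, smul_eq_mul]
    ring
  have hv0 : v ≠ 0 := fun h0 => by
    have := (LinearIndependent.pair_iff.1 h (x ⬝ᵥ s) (-(x ⬝ᵥ x)) (by
      rw [neg_smul, ← sub_eq_add_neg]
      exact h0)).2
    linarith
  have hvv : 0 < v ⬝ᵥ v := by simpa using Matrix.dotProduct_star_self_pos_iff.2 hv0
  have key : v ⬝ᵥ v = -((x ⬝ᵥ x) * (s ⬝ᵥ v)) := by
    conv_lhs => rw [hv]
    rw [← hv, sub_dotProduct, smul_dotProduct, smul_dotProduct, hxv]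
    simp
  exact ⟨v, hxv, by nlinarith⟩


/-- Proposition 1: the total (unconstrained) log-likelihood of the additive hazards
model, `(β_1,…,β_K) ↦ ∑_k [log⟨x^{(k)}, β_k⟩ − ⟨s^{(k)}, β_k⟩]`, is unbounded above
on the set where all `⟨x^{(k)}, β_k⟩ > 0`, provided `x^{(k₀)}` and `s^{(k₀)}` are
linearly independent for at least one `k₀`. -/
theorem total_loglik_unbounded (p K : ℕ) (hp : 1 ≤ p) (hK : 1 ≤ K)
    (x s : Fin K → Fin (p + 1) → ℝ)
    (hx0 : ∀ k, x k 0 = 1)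
    (hind : ∃ k₀, LinearIndependent ℝ ![x k₀, s k₀]) :
    ∀ C : ℝ, ∃ β : Fin K → Fin (p + 1) → ℝ,
      (∀ k, 0 < ∑ j, x k j * β k j) ∧
      C < ∑ k, (Real.log (∑ j, x k j * β k j) - ∑ j, s k j * β k j) := by
  obtain ⟨k₀, h⟩ := hind
  obtain ⟨v, hxv, hsv⟩ := exists_dotProduct_eq_zero_and_dotProduct_neg h
  intro C
  set t : ℝ := (C + ∑ k, s k 0 + 1) / -(s k₀ ⬝ᵥ v) with ht
  let β : Fin K → Fin (p + 1) → ℝ := fun k => Pi.single 0 1 + if k = k₀ then t • v else 0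
  have hxβ : ∀ k, x k ⬝ᵥ β k = 1 := fun k => by
    by_cases hk : k = k₀
    · subst hk
      simp [β, dotProduct_add, hxv, hx0]
    · simp [β, hk, hx0]
  have hsβ : ∀ k, s k ⬝ᵥ β k = s k 0 + if k = k₀ then t * (s k₀ ⬝ᵥ v) else 0 := fun k => by
    by_cases hk : k = k₀
    · subst hk
      simp [β, dotProduct_add]
    · simp [β, hk]
  refine ⟨β, fun k => one_pos.trans_eq (hxβ k).symm, ?_⟩
  change C < ∑ k, (Real.log (x k ⬝ᵥ β k) - s k ⬝ᵥ β k)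
  have htv : t * (s k₀ ⬝ᵥ v) = -(C + ∑ k, s k 0 + 1) := by
    rw [ht]
    field_simp [hsv.ne]
  simp only [hxβ, hsβ, Real.log_one, zero_sub, Finset.sum_neg_distrib, Finset.sum_add_distrib,
    Finset.sum_ite_eq', Finset.mem_univ, if_true, htv]
  linarith
end

section
/- Let p ≥ 1 and n ≥ 1. Let t_1, …, t_n ∈ ℝ be observed times, δ_i ∈ {0,1} event indicators with E = {i : δ_i = 1}, and covariate vectors x_i ∈ ℝ^{p+1} with x_{i,0} = 1 and x_{i,j} ∈ [0,1] for j = 1,…,p. Let D = {β ∈ ℝ^{p+1} : β_0 + Σ_{j∈S} β_j ≥ 0 for all S ⊆ {1,…,p}}. Let T ⊂ ℝ be a finite set of jump times containing {t_i : i ∈ E}, and for each τ ∈ T let β_τ ∈ D. Define ℓ((β_τ)_{τ∈T}) = Σ_{i∈E} log(⟨x_i, β_{t_i}⟩) − Σ_{i=1}^n Σ_{τ ∈ T : τ ≤ t_i} ⟨x_i, β_τ⟩. Then the modified jumps β'_τ defined by β'_τ = β_τ for τ ∈ {t_i : i ∈ E} and β'_τ = 0 otherwise satisfy β'_τ ∈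 D for all τ and ℓ((β'_τ)_{τ∈T}) ≥ ℓ((β_τ)_{τ∈T}). Hence the constrained log-likelihood can only be maximised by step functions whose jumps occur at event time points. -/
/-- A vector whose sums over `0` and any set of further coordinates are nonnegative pairs
nonnegatively with every vector with leading entry `1` and other entries in `[0, 1]`. -/
theorem sum_mul_nonneg_of_subset_sums_nonneg {p : ℕ} {y b : Fin (p + 1) → ℝ} (hy0 : y 0 = 1)
    (hy : ∀ j : Fin p, y j.succ ∈ Set.Icc (0 : ℝ) 1)
    (hb : ∀ S : Finset (Fin p), 0 ≤ b 0 + ∑ j ∈ S, b j.succ) :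
    0 ≤ ∑ j, y j * b j := by
  rw [Fin.sum_univ_succ, hy0, one_mul]
  refine (hb (Finset.univ.filter fun j => b j.succ < 0)).trans ?_
  rw [Finset.sum_filter]
  gcongr with j
  obtain ⟨h0, h1⟩ := hy j
  split_ifs with h
  · nlinarith
  · exact mul_nonneg h0 (not_lt.mp h)

open Finset in
/-- Lemma 1 (step-function form): for a step-function cumulative regression function
with jumps `β_τ ∈ D` at a finite set `T` of times containing all event times,
setting the jumps at non-event times to `0` keeps all jumps in the constraint
cone `D` and does not decrease the constrained log-likelihood. Hence the
constrained log-likelihood can only be maximised by step functions whose jumps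
occur at event time points. -/
theorem jumps_only_at_event_times (p n : ℕ) (hp : 1 ≤ p) (hn : 1 ≤ n)
    (t : Fin n → ℝ) (E : Finset (Fin n)) (x : Fin n → Fin (p + 1) → ℝ)
    (hx0 : ∀ i, x i 0 = 1) (hx : ∀ i, ∀ j : Fin p, x i j.succ ∈ Set.Icc (0 : ℝ) 1)
    (D : Set (Fin (p + 1) → ℝ))
    (hD : D = {β | ∀ S : Finset (Fin p), 0 ≤ β 0 + ∑ j ∈ S, β j.succ})
    (T : Finset ℝ) (hT : ∀ i ∈ E, t i ∈ T)
    (β : ℝ → Fin (p + 1) → ℝ) (hβ : ∀ τ ∈ T, β τ ∈ D)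
    (β' : ℝ → Fin (p + 1) → ℝ)
    (hβ' : β' = fun τ => if τ ∈ E.image t then β τ else 0)
    (ℓ : (ℝ → Fin (p + 1) → ℝ) → ℝ)
    (hℓ : ℓ = fun b => (∑ i ∈ E, Real.log (∑ j, x i j * b (t i) j))
      - ∑ i : Fin n, ∑ τ ∈ T.filter (fun τ => τ ≤ t i), ∑ j, x i j * b τ j) :
    (∀ τ : ℝ, β' τ ∈ D) ∧ ℓ β ≤ ℓ β' := by
  subst hD hβ' hℓ
  refine ⟨fun τ => ?_, ?_⟩
  · dsimp only
    split_ifs with h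
    · obtain ⟨i, hi, rfl⟩ := mem_image.mp h
      exact hβ _ (hT i hi)
    · simp
  · refine sub_le_sub (sum_le_sum fun i hi => ?_) (sum_le_sum fun i _ => sum_le_sum fun τ hτ => ?_)
    · simp only [if_pos (mem_image_of_mem t hi), le_refl]
    · dsimp only
      split_ifs
      · exact le_rfl
      · simpa using sum_mul_nonneg_of_subset_sums_nonneg (hx0 i) (hx i)
          (hβ τ (mem_filter.mp hτ).1)
end

section
/- Let p ≥ 1. Let D = {β ∈ ℝ^{p+1} : β_0 + Σ_{j∈S} β_j ≥ 0 for all S ⊆ {1,…,p}}, and for j = 1,…,p let e_j ∈ ℝ^{p+1} be the standard basis vector with 1 in coordinate j and let f_j = e_0 − e_j, where e_0 is the standard basis vector with 1 in coordinate 0. Then D equals the convex cone generated by the 2p vectors {e_1, …, e_p, f_1, …, f_p}; that is, β ∈ D if and only if β = Σ_{j=1}^p a_j e_j + Σ_{j=1}^p b_j f_j for some nonnegative reals a_1,…,a_p, b_1,…,b_p. -/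
theorem eq_sum_smul_single_add_iff (p : ℕ) (a b : Fin p → ℝ) (β : Fin (p + 1) → ℝ) :
    β = (∑ j, a j • (Pi.single j.succ 1 : Fin (p + 1) → ℝ)) +
        ∑ j, b j • ((Pi.single 0 1 : Fin (p + 1) → ℝ) - Pi.single j.succ 1) ↔
      β 0 = ∑ j, b j ∧ ∀ j : Fin p, β j.succ = a j - b j := by
  rw [funext_iff, Fin.forall_fin_succ]
  simp [Finset.sum_apply, Pi.single_apply, sub_eq_add_neg, eq_comm]

/-- The constraint cone `D = {β : β_0 + ∑_{j∈S} β_j ≥ 0 for all S ⊆ {1,…,p}}` is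
the convex cone generated by the `2p` vectors `e_1,…,e_p, f_1,…,f_p`, where `e_j`
is the standard basis vector with `1` in coordinate `j` and `f_j = e_0 − e_j`. -/
theorem cone_generators (p : ℕ) (hp : 1 ≤ p)
    (e : Fin p → Fin (p + 1) → ℝ) (he : ∀ j, e j = Pi.single j.succ 1)
    (f : Fin p → Fin (p + 1) → ℝ)
    (hf : ∀ j, f j = Pi.single 0 1 - Pi.single j.succ 1)
    (β : Fin (p + 1) → ℝ) :
    (∀ S : Finset (Fin p), 0 ≤ β 0 + ∑ j ∈ S, β j.succ) ↔
      ∃ a b : Fin p → ℝ, (∀ j, 0 ≤ a j) ∧ (∀ j, 0 ≤ b j) ∧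
        β = (∑ j, a j • e j) + ∑ j, b j • f j := by
  obtain rfl : e = fun j => Pi.single j.succ 1 := funext he
  obtain rfl : f = fun j => Pi.single 0 1 - Pi.single j.succ 1 := funext hf
  simp only [eq_sum_smul_single_add_iff]
  constructor
  · intro h
    let i : Fin p := ⟨0, hp⟩
    let c := β 0 - ∑ j, max (-β (Fin.succ j)) 0
    have hc : 0 ≤ c := by
      have hS := h {j | β j.succ ≤ 0}
      have key : ∑ j, max (-β (Fin.succ j)) 0 = -∑ j with β (Fin.succ j) ≤ 0, β j.succ := by
        rw [Finset.sum_filter, ← Finset.sum_neg_distrib]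
        refine Finset.sum_congr rfl fun j _ => ?_
        split_ifs with hj
        · exact max_eq_left (by linarith)
        · rw [neg_zero]
          exact max_eq_right (by linarith)
      simp only [c, key]
      linarith
    have hci (j : Fin p) : 0 ≤ if j = i then c else 0 := by
      split_ifs <;> simp [hc]
    refine ⟨fun j => β j.succ + (max (-β j.succ) 0 + if j = i then c else 0),
      fun j => max (-β j.succ) 0 + if j = i then c else 0,
      fun j => ?_, fun j => add_nonneg (le_max_right _ _) (hci j), ?_, fun j => by ring⟩
    · have := le_max_left (-β j.succ) 0
      linarith [hci j]
    · simp [Finset.sum_add_distrib, c]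
  · rintro ⟨a, b, ha, hb, h0, hsucc⟩ S
    have hSb : ∑ j ∈ S, b j ≤ ∑ j, b j :=
      Finset.sum_le_sum_of_subset_of_nonneg (Finset.subset_univ S) fun j _ _ => hb j
    have hSa : 0 ≤ ∑ j ∈ S, a j := Finset.sum_nonneg fun j _ => ha j
    simp only [h0, hsucc, Finset.sum_sub_distrib]
    linarith
end

section
/- Let p ≥ 1 and let s ∈ ℝ^{p+1} (coordinates indexed 0, 1, …, p) satisfy s_j > 0 and s_0 − s_j > 0 for every j = 1,…,p. Let D = {β ∈ ℝ^{p+1} : β_0 + Σ_{j∈S} β_j ≥ 0 for all S ⊆ {1,…,p}}. Then ⟨s, β⟩ > 0 for every β ∈ D with β ≠ 0. -/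
/-- If `s_j > 0` and `s_0 − s_j > 0` for every `j = 1,…,p` (the at-risk covariate
values in each coordinate are neither all zero nor all one), then `⟨s, β⟩ > 0` for
every nonzero `β` in the constraint cone
`D = {β : β_0 + ∑_{j∈S} β_j ≥ 0 for all S ⊆ {1,…,p}}`. -/
theorem inner_pos_on_cone (p : ℕ) (hp : 1 ≤ p) (s : Fin (p + 1) → ℝ)
    (hs : ∀ j : Fin p, 0 < s j.succ) (hs0 : ∀ j : Fin p, 0 < s 0 - s j.succ)
    (β : Fin (p + 1) → ℝ)
    (hβ : ∀ S : Finset (Fin p), 0 ≤ β 0 + ∑ j ∈ S, β j.succ)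
    (hβ0 : β ≠ 0) :
    0 < ∑ j, s j * β j := by
  have hs0_pos : 0 < s 0 := by linarith [hs ⟨0, hp⟩, hs0 ⟨0, hp⟩]
  let N : Finset (Fin p) := Finset.univ.filter fun j => β j.succ < 0
  let t : Fin p → ℝ := fun j =>
    s j.succ * β j.succ - s 0 * (if β j.succ < 0 then β j.succ else 0)
  have hdecomp : ∑ j, s j * β j = s 0 * (β 0 + ∑ j ∈ N, β j.succ) + ∑ j, t j := by
    simp only [t, N, Fin.sum_univ_succ (fun j => s j * β j), Finset.sum_sub_distrib,
      ← Finset.mul_sum, Finset.sum_filter]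
    ring
  have ht_pos : ∀ j, β j.succ ≠ 0 → 0 < t j := by
    intro j hj
    rcases lt_or_gt_of_ne hj with h | h
    · simp only [t, if_pos h]
      nlinarith [mul_pos (hs0 j) (neg_pos.mpr h)]
    · simpa [t, not_lt.mpr h.le] using mul_pos (hs j) h
  have ht_nonneg : ∀ j, 0 ≤ t j := by
    intro j
    by_cases hj : β j.succ = 0
    · simp [t, hj]
    · exact (ht_pos j hj).le
  rw [hdecomp]
  by_cases h : ∃ j : Fin p, β j.succ ≠ 0
  · obtain ⟨j, hj⟩ := h
    exact add_pos_of_nonneg_of_pos (mul_nonneg hs0_pos.le (hβ N))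
      (Finset.sum_pos' (fun i _ => ht_nonneg i) ⟨j, Finset.mem_univ j, ht_pos j hj⟩)
  · push Not at h
    have hβ_zero_ne : β 0 ≠ 0 := fun h0 => hβ0 (funext (Fin.cases h0 h))
    have hβ_zero_pos : 0 < β 0 :=
      lt_of_le_of_ne (by simpa using hβ ∅) hβ_zero_ne.symm
    refine add_pos_of_pos_of_nonneg (mul_pos hs0_pos ?_)
      (Finset.sum_nonneg fun i _ => ht_nonneg i)
    simpa [h] using hβ_zero_pos
end

section
/- Let p ≥ 1 and let D = {β ∈ ℝ^{p+1} : ⟨m, β⟩ ≥ 0 for every m ∈ {1}×{0,1}^p}, where {1}×{0,1}^p denotes the set of vectors in ℝ^{p+1} whose coordinate 0 equals 1 and whose remaining coordinates are each 0 or 1. Suppose β ∈ D and the linear span of the active constraint normals {m ∈ {1}×{0,1}^p : ⟨m, β⟩ = 0} has dimension at least p. Then there exist j ∈ {1,…,p} and l ≥ 0 such that either β = l·e_j or β = l·f_j, where e_j is the standard basis vector with 1 in coordinate j and f_j = e_0 − e_j. In other words, the one-dimensional line edges on the boundary of D are exactly the rays spanned by (0,…,0,l,0,…,0) with l in one of positions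 1,…,p, and by (l,0,…,0,−l,0,…,0) with −l in one of positions 1,…,p. -/
/-- Flipping one coordinate of an active constraint to `t ∈ {0, 1}` keeps it a constraint. -/
lemma active_flip_nonneg {p : ℕ} {β m : Fin (p + 1) → ℝ}
    (hβ : ∀ m : Fin (p + 1) → ℝ, m 0 = 1 →
      (∀ j : Fin p, m j.succ = 0 ∨ m j.succ = 1) → 0 ≤ ∑ j, m j * β j)
    (h0 : m 0 = 1) (h1 : ∀ j : Fin p, m j.succ = 0 ∨ m j.succ = 1)
    (hs : ∑ j, m j * β j = 0) (j : Fin p) {t : ℝ} (ht : t = 0 ∨ t = 1) :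
    0 ≤ (t - m j.succ) * β j.succ := by
  have h := hβ (m + Pi.single j.succ (t - m j.succ)) (by simp [h0]) fun k => by
    rcases eq_or_ne k j with rfl | hkj
    · simpa using ht
    · simpa [hkj] using h1 k
  simpa [add_mul, Finset.sum_add_distrib, hs, Pi.single_apply] using h

/-- On active constraints, a coordinate with nonzero coefficient is `1` exactly when the
coefficient is negative. -/
lemma active_coord_eq {p : ℕ} {β m : Fin (p + 1) → ℝ}
    (hβ : ∀ m : Fin (p + 1) → ℝ, m 0 = 1 →
      (∀ j : Fin p, m j.succ = 0 ∨ m j.succ = 1) → 0 ≤ ∑ j, m j * β j)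
    (h0 : m 0 = 1) (h1 : ∀ j : Fin p, m j.succ = 0 ∨ m j.succ = 1)
    (hs : ∑ j, m j * β j = 0) (j : Fin p) (hj : β j.succ ≠ 0) :
    m j.succ = if 0 < β j.succ then 0 else 1 := by
  have ha := active_flip_nonneg hβ h0 h1 hs j (Or.inl rfl)
  have hb := active_flip_nonneg hβ h0 h1 hs j (Or.inr rfl)
  rcases hj.lt_or_gt with hneg | hpos
  · rw [if_neg hneg.not_gt]
    rcases h1 j with h | h
    · rw [h] at hb; linarith
    · exact h
  · rw [if_pos hpos]
    rcases h1 j with h | h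
    · exact h
    · rw [h] at ha; linarith

/-- A subspace on which two distinct coordinates are multiples of coordinate `0` has codimension
at least two. -/
lemma finrank_lt_of_two_coords {p : ℕ} {S : Submodule ℝ (Fin (p + 1) → ℝ)} {j k : Fin p}
    (hjk : j ≠ k) (a b : ℝ) (hS : ∀ m ∈ S, m j.succ = a * m 0 ∧ m k.succ = b * m 0) :
    Module.finrank ℝ S < p := by
  let φ : (Fin (p + 1) → ℝ) →ₗ[ℝ] ℝ × ℝ :=
    LinearMap.prod (LinearMap.proj j.succ - a • LinearMap.proj 0)
      (LinearMap.proj k.succ - b • LinearMap.proj 0)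
  have hφ : Function.Surjective φ := by
    rintro ⟨x, y⟩
    refine ⟨Pi.single j.succ x + Pi.single k.succ y, ?_⟩
    simp [φ, hjk, hjk.symm]
  have hle : S ≤ LinearMap.ker φ := fun m hm => by
    simp [φ, hS m hm]
  have hker := φ.finrank_range_add_finrank_ker
  rw [LinearMap.range_eq_top.2 hφ] at hker
  have := Submodule.finrank_mono hle
  simp at hker
  omega

/-- Lemma 3: if `β` lies in the cone `D = {β : ⟨m, β⟩ ≥ 0 for all m ∈ {1}×{0,1}^p}`
and the active constraint normals at `β` span a subspace of dimension at least `p`,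
then `β` lies on one of the `2p` one-dimensional edge rays of `D`: `β = l·e_j` or
`β = l·f_j` for some `j ∈ {1,…,p}` and `l ≥ 0`, where `e_j` is the standard basis
vector with `1` in coordinate `j` and `f_j = e_0 − e_j`. -/
theorem edges_of_cone (p : ℕ) (hp : 1 ≤ p) (β : Fin (p + 1) → ℝ)
    (hβ : ∀ m : Fin (p + 1) → ℝ, m 0 = 1 →
      (∀ j : Fin p, m j.succ = 0 ∨ m j.succ = 1) → 0 ≤ ∑ j, m j * β j)
    (hrank : p ≤ Module.finrank ℝ (Submodule.span ℝ
      {m : Fin (p + 1) → ℝ | m 0 = 1 ∧ (∀ j : Fin p, m j.succ = 0 ∨ m j.succ = 1) ∧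
        ∑ j, m j * β j = 0})) :
    ∃ (j : Fin p) (l : ℝ), 0 ≤ l ∧
      (β = l • (Pi.single j.succ 1 : Fin (p + 1) → ℝ) ∨
        β = l • ((Pi.single 0 1 - Pi.single j.succ 1) : Fin (p + 1) → ℝ)) := by
  set A := {m : Fin (p + 1) → ℝ | m 0 = 1 ∧ (∀ j : Fin p, m j.succ = 0 ∨ m j.succ = 1) ∧
    ∑ j, m j * β j = 0}
  obtain ⟨m, h0, h1, hs⟩ : A.Nonempty := by
    by_contra! h
    rw [h, Submodule.span_empty, finrank_bot] at hrank
    omega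
  have huniq : ∀ j k : Fin p, β j.succ ≠ 0 → β k.succ ≠ 0 → j = k := by
    intro j k hj hk
    by_contra hjk
    refine (finrank_lt_of_two_coords (S := Submodule.span ℝ A) hjk
      (if 0 < β j.succ then 0 else 1) (if 0 < β k.succ then 0 else 1) fun m hm => ?_).not_ge hrank
    induction hm using Submodule.span_induction with
    | mem m hm =>
      obtain ⟨h0, h1, hs⟩ := hm
      rw [h0, mul_one, mul_one]
      exact ⟨active_coord_eq hβ h0 h1 hs j hj, active_coord_eq hβ h0 h1 hs k hk⟩
    | zero => simp
    | add x y _ _ hx hy =>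
      simp only [Pi.add_apply, hx.1, hx.2, hy.1, hy.2, mul_add, and_self]
    | smul c x _ hx =>
      simp only [Pi.smul_apply, smul_eq_mul, hx.1, hx.2]
      constructor <;> ring
  obtain ⟨j, hj⟩ : ∃ j : Fin p, ∀ k, k ≠ j → β k.succ = 0 := by
    by_cases h : ∃ j : Fin p, β j.succ ≠ 0
    · obtain ⟨j, hj⟩ := h
      exact ⟨j, fun k hkj => by_contra fun hk => hkj (huniq k j hk hj)⟩
    · push Not at h
      exact ⟨⟨0, hp⟩, fun k _ => h k⟩
  have hsum : β 0 + m j.succ * β j.succ = 0 := by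
    rw [Fin.sum_univ_succ, h0, one_mul,
      Finset.sum_eq_single j (fun k _ hkj => by rw [hj k hkj, mul_zero]) (by simp)] at hs
    exact hs
  have hflip {t : ℝ} (ht : t = 0 ∨ t = 1) := active_flip_nonneg hβ h0 h1 hs j ht
  have hz := hflip (Or.inl rfl)
  have ho := hflip (Or.inr rfl)
  rcases h1 j with h | h <;> rw [h] at hsum hz ho
  · refine ⟨j, β j.succ, by linarith, Or.inl (funext (Fin.cases ?_ fun k => ?_))⟩
    · simp; linarith
    · rcases eq_or_ne k j with rfl | hkj
      · simp
      · simp [hj k hkj, hkj]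
  · refine ⟨j, -β j.succ, by linarith, Or.inr (funext (Fin.cases ?_ fun k => ?_))⟩
    · simp; linarith
    · rcases eq_or_ne k j with rfl | hkj
      · simp
      · simp [hj k hkj, hkj]
end

section
/- Let p ≥ 1. Let x ∈ ℝ^{p+1} with x_0 = 1 and x_j ∈ [0,1] for j = 1,…,p, and let s ∈ ℝ^{p+1} with s_j > 0 and s_0 − s_j > 0 for j = 1,…,p. Let D = {β ∈ ℝ^{p+1} : β_0 + Σ_{j∈S} β_j ≥ 0 for all S ⊆ {1,…,p}} and define ℓ*(β) = log(⟨x, β⟩) − ⟨s, β⟩ on D ∩ {β : ⟨x, β⟩ > 0}. Then there exist j ∈ {1,…,p}, l > 0, and β** equal to l·e_j or l·f_j (where e_j is the standard basis vector with 1 in coordinate j and f_j = e_0 − e_j) such that ⟨x, β**⟩ > 0 and ℓ*(β**) ≥ ℓ*(β) for every β ∈ D with ⟨x, β⟩ > 0. That is, the maximum of ℓ* over D is attained at a point lying on a one-dimensional edge of D, i.e., in the intersection of p flat boundaries of D. -/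
/-- A functional which is nonnegative on `e_0`, on every `e_j` and on every `e_0 - e_j` is
nonnegative on the cone cut out by the inequalities `β_0 + ∑_{j∈S} β_j ≥ 0`. -/
theorem sum_mul_nonneg_of_forall_finset {p : ℕ} {a β : Fin (p + 1) → ℝ} (h0 : 0 ≤ a 0)
    (ha : ∀ j : Fin p, 0 ≤ a j.succ) (ha0 : ∀ j : Fin p, a j.succ ≤ a 0)
    (hβ : ∀ S : Finset (Fin p), 0 ≤ β 0 + ∑ i ∈ S, β i.succ) :
    0 ≤ ∑ i, a i * β i := by
  have hneg := mul_nonneg h0 (hβ {j | β j.succ < 0})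
  have hsum : a 0 * ∑ j with β (Fin.succ j) < 0, β j.succ ≤ ∑ j : Fin p, a j.succ * β j.succ := by
    rw [Finset.sum_filter, Finset.mul_sum]
    refine Finset.sum_le_sum fun j _ => ?_
    split_ifs with h
    · exact mul_le_mul_of_nonpos_right (ha0 j) h.le
    · simpa using mul_nonneg (ha j) (not_lt.mp h)
  rw [Fin.sum_univ_succ]
  linarith

theorem log_sub_le_log_sub_one {M X S : ℝ} (hM : 0 < M) (hX : 0 < X) (h : X ≤ M * S) :
    Real.log X - S ≤ Real.log M - 1 := by
  have hlog := Real.log_le_sub_one_of_pos (div_pos hX hM)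
  rw [Real.log_div hX.ne' hM.ne'] at hlog
  have hS : X / M ≤ S := (div_le_iff₀' hM).mpr h
  linarith

theorem sum_mul_smul {ι : Type*} [Fintype ι] (a v : ι → ℝ) (l : ℝ) :
    ∑ i, a i * (l • v) i = l * ∑ i, a i * v i := by
  simp only [Pi.smul_apply, smul_eq_mul, Finset.mul_sum, mul_left_comm]

/-- The direction vectors `e_j` (on `Sum.inl j`) and `e_0 - e_j` (on `Sum.inr j`) of the
one-dimensional edges of the cone. -/
def edgeVector {p : ℕ} : Fin p ⊕ Fin p → Fin (p + 1) → ℝ :=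
  Sum.elim (fun j => Pi.single j.succ 1) (fun j => Pi.single 0 1 - Pi.single j.succ 1)

theorem sum_mul_edgeVector_inl {p : ℕ} (a : Fin (p + 1) → ℝ) (j : Fin p) :
    ∑ i, a i * edgeVector (Sum.inl j) i = a j.succ := by
  simp [edgeVector, Pi.single_apply]

theorem sum_mul_edgeVector_inr {p : ℕ} (a : Fin (p + 1) → ℝ) (j : Fin p) :
    ∑ i, a i * edgeVector (Sum.inr j) i = a 0 - a j.succ := by
  simp [edgeVector, Pi.single_apply, mul_sub]

theorem edgeVector_mem_cone {p : ℕ} (k : Fin p ⊕ Fin p) (S : Finset (Fin p)) :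
    0 ≤ edgeVector k 0 + ∑ i ∈ S, edgeVector k i.succ := by
  rcases k with j | j
  · simp only [edgeVector, Sum.elim_inl, Pi.single_apply, Fin.succ_inj, Finset.sum_ite_eq']
    split_ifs <;> simp_all
  · simp only [edgeVector, Sum.elim_inr, Pi.sub_apply, Pi.single_apply, Fin.succ_inj,
      Finset.sum_sub_distrib, Finset.sum_ite_eq']
    by_cases hj : j ∈ S <;> simp [hj, Fin.succ_ne_zero, (Fin.succ_ne_zero _).symm]


/-- Lemmas 2 and 3 combined: the maximum of the constrained per-event-time
log-likelihood `ℓ*(β) = log⟨x, β⟩ − ⟨s, β⟩` over the constraint cone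
`D = {β : β_0 + ∑_{j∈S} β_j ≥ 0 for all S ⊆ {1,…,p}}` is attained at a point
`β** = l·e_j` or `β** = l·f_j` (`l > 0`) lying on a one-dimensional edge of `D`. -/
theorem max_on_edge (p : ℕ) (hp : 1 ≤ p)
    (x : Fin (p + 1) → ℝ) (hx0 : x 0 = 1)
    (hx : ∀ j : Fin p, x j.succ ∈ Set.Icc (0 : ℝ) 1)
    (s : Fin (p + 1) → ℝ)
    (hs : ∀ j : Fin p, 0 < s j.succ) (hs0 : ∀ j : Fin p, 0 < s 0 - s j.succ) :
    ∃ (j : Fin p) (l : ℝ) (βstar : Fin (p + 1) → ℝ), 0 < l ∧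
      (βstar = l • (Pi.single j.succ 1 : Fin (p + 1) → ℝ) ∨
        βstar = l • ((Pi.single 0 1 - Pi.single j.succ 1) : Fin (p + 1) → ℝ)) ∧
      (∀ S : Finset (Fin p), 0 ≤ βstar 0 + ∑ i ∈ S, βstar i.succ) ∧
      0 < ∑ i, x i * βstar i ∧
      ∀ β : Fin (p + 1) → ℝ,
        (∀ S : Finset (Fin p), 0 ≤ β 0 + ∑ i ∈ S, β i.succ) →
        0 < ∑ i, x i * β i →
        Real.log (∑ i, x i * β i) - ∑ i, s i * β i ≤
          Real.log (∑ i, x i * βstar i) - ∑ i, s i * βstar i := by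
  have hs_pos : ∀ k : Fin p ⊕ Fin p, 0 < ∑ i, s i * edgeVector k i := by
    rintro (j | j)
    · simpa only [sum_mul_edgeVector_inl] using hs j
    · simpa only [sum_mul_edgeVector_inr] using hs0 j
  let j₀ : Fin p := ⟨0, hp⟩
  have : Nonempty (Fin p ⊕ Fin p) := ⟨Sum.inl j₀⟩
  obtain ⟨k, hk⟩ := Finite.exists_max fun k : Fin p ⊕ Fin p =>
    (∑ i, x i * edgeVector k i) / ∑ i, s i * edgeVector k i
  set v := edgeVector k
  set σ := ∑ i, s i * v i with hσ
  have hσ_pos : 0 < σ := hs_pos k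
  set M := (∑ i, x i * v i) / σ with hM
  have hle : ∀ k, ∑ i, x i * edgeVector k i ≤ M * ∑ i, s i * edgeVector k i :=
    fun k => (div_le_iff₀ (hs_pos k)).mp (hk k)
  have hle_inl : ∀ j : Fin p, x j.succ ≤ M * s j.succ := fun j => by
    simpa only [sum_mul_edgeVector_inl] using hle (Sum.inl j)
  have hle_inr : ∀ j : Fin p, x 0 - x j.succ ≤ M * (s 0 - s j.succ) := fun j => by
    simpa only [sum_mul_edgeVector_inr] using hle (Sum.inr j)
  have hM_pos : 0 < M := by
    have hs0_pos : 0 < s 0 := by linarith [hs j₀, hs0 j₀]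
    refine pos_of_mul_pos_left (b := s 0) ?_ hs0_pos.le
    linarith [hle_inl j₀, hle_inr j₀]
  have hXstar : ∑ i, x i * (σ⁻¹ • v) i = M := by
    rw [sum_mul_smul, hM, div_eq_inv_mul]
  have hSstar : ∑ i, s i * (σ⁻¹ • v) i = 1 := by
    rw [sum_mul_smul, ← hσ, inv_mul_cancel₀ hσ_pos.ne']
  have hcone : ∀ S : Finset (Fin p), 0 ≤ (σ⁻¹ • v) 0 + ∑ i ∈ S, (σ⁻¹ • v) i.succ := fun S => by
    simp only [Pi.smul_apply, ← Finset.smul_sum, ← smul_add]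
    exact smul_nonneg (inv_pos.mpr hσ_pos).le (edgeVector_mem_cone k S)
  have hmax : ∀ β : Fin (p + 1) → ℝ,
      (∀ S : Finset (Fin p), 0 ≤ β 0 + ∑ i ∈ S, β i.succ) → 0 < ∑ i, x i * β i →
      Real.log (∑ i, x i * β i) - ∑ i, s i * β i ≤ Real.log M - 1 := fun β hβ hX => by
    refine log_sub_le_log_sub_one hM_pos hX ?_
    have hnonneg := sum_mul_nonneg_of_forall_finset (a := fun i => M * s i - x i)
      (by linarith [hle_inl j₀, hle_inr j₀]) (fun j => sub_nonneg.mpr (hle_inl j))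
      (fun j => by linarith [hle_inr j]) hβ
    simpa only [sub_mul, mul_assoc, Finset.sum_sub_distrib, ← Finset.mul_sum, sub_nonneg]
      using hnonneg
  refine ⟨k.elim id id, σ⁻¹, σ⁻¹ • v, inv_pos.mpr hσ_pos, ?_, hcone, hXstar ▸ hM_pos, ?_⟩
  · rcases k with j | j
    · exact Or.inl rfl
    · exact Or.inr rfl
  · rwa [hXstar, hSstar]
end

section
/- Let p ≥ 1. Let x ∈ ℝ^{p+1} with x_0 = 1 and x_j ∈ [0,1] for j = 1,…,p, and let s ∈ ℝ^{p+1} with s_j > 0 and s_0 − s_j > 0 for j = 1,…,p. Let D = {β ∈ ℝ^{p+1} : β_0 + Σ_{j∈S} β_j ≥ 0 for all S ⊆ {1,…,p}}. Define the 2p ratios v_j = x_j / s_j for j = 1,…,p and v_{p+j} = (1 − x_j) / (s_0 − s_j) for j = 1,…,p, and let m* ∈ {1,…,2p} attain the maximum v_{m*} = max_{1 ≤ m ≤ 2p} v_m. Define β̂ = (1/s_{m*})·e_{m*} if 1 ≤ m* ≤ p and β̂ = (1/(s_0 − s_{m*−p}))·f_{m*−p} if p+1 ≤ m* ≤ 2p,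 where e_j is the standard basis vector of ℝ^{p+1} with 1 in coordinate j and f_j = e_0 − e_j. Then: (i) v_{m*} > 0; (ii) β̂ ∈ D and ⟨x, β̂⟩ = v_{m*} > 0; (iii) log(⟨x, β̂⟩) − ⟨s, β̂⟩ = log(v_{m*}) − 1; and (iv) for every β ∈ D with ⟨x, β⟩ > 0, log(⟨x, β⟩) − ⟨s, β⟩ ≤ log(v_{m*}) − 1. Hence β̂ maximises the constrained per-event-time log-likelihood. -/
/-- The cone of vectors whose partial sums `β 0 + ∑ i ∈ S, β i.succ` are all nonnegative pairs
nonnegatively with every `w` such that `0 ≤ w j.succ ≤ w 0`. -/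
lemma sum_mul_nonneg_of_partial_sums_nonneg {p : ℕ} (w β : Fin (p + 1) → ℝ) (hw0 : 0 ≤ w 0)
    (hw : ∀ j : Fin p, 0 ≤ w j.succ) (hw' : ∀ j : Fin p, w j.succ ≤ w 0)
    (hβ : ∀ S : Finset (Fin p), 0 ≤ β 0 + ∑ i ∈ S, β i.succ) :
    0 ≤ ∑ i, w i * β i := by
  rw [Fin.sum_univ_succ]
  have h := mul_nonneg hw0 (hβ (Finset.univ.filter fun j => β j.succ < 0))
  rw [mul_add, Finset.sum_filter, Finset.mul_sum] at h
  refine h.trans (add_le_add le_rfl (Finset.sum_le_sum fun j _ => ?_))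
  split_ifs with hj
  · exact mul_le_mul_of_nonpos_right (hw' j) hj.le
  · simpa using mul_nonneg (hw j) (not_lt.mp hj)

lemma log_sub_le_log_sub_one_s9 {t u v : ℝ} (ht : 0 < t) (hv : 0 < v) (h : t ≤ v * u) :
    Real.log t - u ≤ Real.log v - 1 := by
  have hlog := Real.log_le_sub_one_of_pos (div_pos ht hv)
  rw [Real.log_div ht.ne' hv.ne'] at hlog
  have : t / v ≤ u := by rwa [div_le_iff₀' hv]
  linarith

/-- Theorem 1 (correctness of Algorithm 1): index the `2p` candidate directions by
`Fin p ⊕ Fin p` (left = `e_j`-directions, right = `f_j`-directions). With ratios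
`v_j = x_j / s_j` and `v_{p+j} = (1 − x_j)/(s_0 − s_j)`, a maximising index `m*`
yields the estimator `β̂ = e_{m*}/s_{m*}` (resp. `f_{m*−p}/(s_0 − s_{m*−p})`), which
lies in the constraint cone `D`, satisfies `⟨x, β̂⟩ = v_{m*} > 0`,
`log⟨x, β̂⟩ − ⟨s, β̂⟩ = log(v_{m*}) − 1`, and maximises the constrained
per-event-time log-likelihood over `D ∩ {⟨x, β⟩ > 0}`. -/
theorem algorithm_one_correct (p : ℕ) (hp : 1 ≤ p)
    (x : Fin (p + 1) → ℝ) (hx0 : x 0 = 1)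
    (hx : ∀ j : Fin p, x j.succ ∈ Set.Icc (0 : ℝ) 1)
    (s : Fin (p + 1) → ℝ)
    (hs : ∀ j : Fin p, 0 < s j.succ) (hs0 : ∀ j : Fin p, 0 < s 0 - s j.succ)
    (v : Fin p ⊕ Fin p → ℝ)
    (hv : ∀ j : Fin p, v (Sum.inl j) = x j.succ / s j.succ)
    (hv' : ∀ j : Fin p, v (Sum.inr j) = (1 - x j.succ) / (s 0 - s j.succ))
    (βhat : Fin p ⊕ Fin p → Fin (p + 1) → ℝ)
    (hβhat : ∀ j : Fin p,
      βhat (Sum.inl j) = (1 / s j.succ) • (Pi.single j.succ 1 : Fin (p + 1) → ℝ))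
    (hβhat' : ∀ j : Fin p, βhat (Sum.inr j) =
      (1 / (s 0 - s j.succ)) • ((Pi.single 0 1 - Pi.single j.succ 1) : Fin (p + 1) → ℝ))
    (mstar : Fin p ⊕ Fin p) (hmax : ∀ m, v m ≤ v mstar) :
    0 < v mstar ∧
    (∀ S : Finset (Fin p), 0 ≤ βhat mstar 0 + ∑ i ∈ S, βhat mstar i.succ) ∧
    (∑ i, x i * βhat mstar i) = v mstar ∧
    Real.log (∑ i, x i * βhat mstar i) - ∑ i, s i * βhat mstar i =
      Real.log (v mstar) - 1 ∧
    ∀ β : Fin (p + 1) → ℝ,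
      (∀ S : Finset (Fin p), 0 ≤ β 0 + ∑ i ∈ S, β i.succ) →
      0 < ∑ i, x i * β i →
      Real.log (∑ i, x i * β i) - ∑ i, s i * β i ≤ Real.log (v mstar) - 1 := by
  have hpos : 0 < v mstar := by
    let j : Fin p := ⟨0, hp⟩
    rcases (hx j).1.lt_or_eq with h | h
    · exact (hv j ▸ div_pos h (hs j)).trans_le (hmax _)
    · refine lt_of_lt_of_le ?_ (hmax (Sum.inr j))
      rw [hv', ← h]
      exact div_pos (by norm_num) (hs0 j)
  have hcone : ∀ S : Finset (Fin p), 0 ≤ βhat mstar 0 + ∑ i ∈ S, βhat mstar i.succ := by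
    intro S
    rcases mstar with j | j
    · have := (hs j).le
      simp only [hβhat, Pi.smul_apply, smul_eq_mul, Pi.single_apply, Fin.succ_inj]
      refine add_nonneg ?_ (Finset.sum_nonneg fun i _ => ?_) <;> split_ifs <;> simp [this]
    · have := (hs0 j).le
      simp only [hβhat', Pi.smul_apply, Pi.sub_apply, smul_eq_mul, Pi.single_apply, Fin.succ_inj,
        ← Finset.mul_sum, ← mul_add]
      refine mul_nonneg (one_div_nonneg.mpr this) ?_
      by_cases hj : j ∈ S <;> simp [hj, (Fin.succ_ne_zero _).symm]
  have hpair_inl : ∀ (y : Fin (p + 1) → ℝ) (j : Fin p),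
      ∑ i, y i * βhat (Sum.inl j) i = y j.succ / s j.succ := by
    intro y j
    simp [hβhat, Pi.single_apply, div_eq_mul_inv]
  have hpair_inr : ∀ (y : Fin (p + 1) → ℝ) (j : Fin p),
      ∑ i, y i * βhat (Sum.inr j) i = (y 0 - y j.succ) / (s 0 - s j.succ) := by
    intro y j
    simp only [hβhat', Pi.smul_apply, Pi.sub_apply, smul_eq_mul, mul_left_comm (y _),
      ← Finset.mul_sum, mul_sub, Finset.sum_sub_distrib]
    simp [Pi.single_apply]
    ring
  have hxβ : ∑ i, x i * βhat mstar i = v mstar := by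
    rcases mstar with j | j
    · rw [hpair_inl, hv]
    · rw [hpair_inr, hv', hx0]
  have hsβ : ∑ i, s i * βhat mstar i = 1 := by
    rcases mstar with j | j
    · rw [hpair_inl, div_self (hs j).ne']
    · rw [hpair_inr, div_self (hs0 j).ne']
  refine ⟨hpos, hcone, hxβ, by rw [hxβ, hsβ], fun β hβ hxpos => ?_⟩
  refine log_sub_le_log_sub_one_s9 hxpos hpos ?_
  have hl : ∀ j : Fin p, x j.succ ≤ v mstar * s j.succ := fun j => by
    have := hmax (Sum.inl j)
    rwa [hv, div_le_iff₀ (hs j)] at this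
  have hr : ∀ j : Fin p, 1 - x j.succ ≤ v mstar * (s 0 - s j.succ) := fun j => by
    have := hmax (Sum.inr j)
    rwa [hv', div_le_iff₀ (hs0 j)] at this
  have hw : ∀ j : Fin p, 0 ≤ v mstar * s j.succ - x j.succ := fun j => sub_nonneg.mpr (hl j)
  have hw' : ∀ j : Fin p, v mstar * s j.succ - x j.succ ≤ v mstar * s 0 - x 0 := fun j => by
    linarith [hr j]
  have key := sum_mul_nonneg_of_partial_sums_nonneg (fun i => v mstar * s i - x i) β
    ((hw ⟨0, hp⟩).trans (hw' ⟨0, hp⟩)) hw hw' hβ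
  simpa only [sub_mul, mul_assoc, Finset.sum_sub_distrib, ← Finset.mul_sum, sub_nonneg] using key
end

section
/- Let n₀ and n₁ be positive real numbers (the numbers of at-risk subjects with covariate value 0 and 1, respectively) and let x₁ ∈ {0,1} be the covariate value of the subject failing at the given event time. Define β̂ = (β̂₀, β̂₁) ∈ ℝ² by β̂₀ = (1 − x₁)/n₀ and β̂₁ = x₁/n₁ − (1 − x₁)/n₀. Then: (i) β̂ is the unique solution of the ordinary least squares normal equations (n₀ + n₁)β₀ + n₁β₁ = 1 and n₁β₀ + n₁β₁ = x₁ (Aalen's estimator at this event time); and (ii) β̂ satisfies β̂₀ ≥ 0, β̂₀ + β̂₁ ≥ 0, β̂₀ + x₁β̂₁ > 0, and for every β = (β₀, β₁) ∈ ℝ² with β₀ ≥ 0, β₀ + β₁ ≥ 0 and β₀ + x₁β₁ > 0, one has log(β₀ + x₁β₁) − (n₀ + n₁)β₀ − n₁β₁ ≤ log(β̂₀ + x₁β̂₁) − (n₀ + n₁)β̂₀ − n₁β̂₁. Hence for a single binary covariate the maximum likelihood estimator and Aalen's ordinary least squares estimator coincide. -/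
/-- For `n > 0`, the function `t ↦ log t - n * t` on the positive reals is maximal at `1 / n`. -/
theorem log_sub_mul_le {n t : ℝ} (hn : 0 < n) (ht : 0 < t) :
    Real.log t - n * t ≤ Real.log (1 / n) - 1 := by
  have h := Real.log_le_sub_one_of_pos (mul_pos hn ht)
  rw [Real.log_mul hn.ne' ht.ne'] at h
  rw [one_div, Real.log_inv]
  linarith

/-- Proposition 2: for a single binary covariate, the maximum likelihood estimator
and Aalen's ordinary least squares estimator coincide. With `n₀, n₁ > 0` at-risk
subjects having covariate `0` resp. `1` and failing subject's covariate
`x₁ ∈ {0,1}`, the vector `β̂ = ((1−x₁)/n₀, x₁/n₁ − (1−x₁)/n₀)` is (i) the unique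
solution of the OLS normal equations, and (ii) lies in the constraint domain and
maximises the constrained per-event-time log-likelihood
`log(β₀ + x₁β₁) − (n₀+n₁)β₀ − n₁β₁`. -/
theorem mle_equals_ols_binary (n₀ n₁ : ℝ) (hn₀ : 0 < n₀) (hn₁ : 0 < n₁)
    (x₁ : ℝ) (hx₁ : x₁ = 0 ∨ x₁ = 1)
    (βhat₀ βhat₁ : ℝ)
    (hβhat₀ : βhat₀ = (1 - x₁) / n₀)
    (hβhat₁ : βhat₁ = x₁ / n₁ - (1 - x₁) / n₀) :
    (∀ β₀ β₁ : ℝ,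
      ((n₀ + n₁) * β₀ + n₁ * β₁ = 1 ∧ n₁ * β₀ + n₁ * β₁ = x₁) ↔
        (β₀ = βhat₀ ∧ β₁ = βhat₁)) ∧
    0 ≤ βhat₀ ∧ 0 ≤ βhat₀ + βhat₁ ∧ 0 < βhat₀ + x₁ * βhat₁ ∧
    ∀ β₀ β₁ : ℝ, 0 ≤ β₀ → 0 ≤ β₀ + β₁ → 0 < β₀ + x₁ * β₁ →
      Real.log (β₀ + x₁ * β₁) - (n₀ + n₁) * β₀ - n₁ * β₁ ≤
        Real.log (βhat₀ + x₁ * βhat₁) - (n₀ + n₁) * βhat₀ - n₁ * βhat₁ := by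
  have h₀ : n₀ * βhat₀ = 1 - x₁ := by rw [hβhat₀]; field_simp
  have h₁ : n₁ * (βhat₀ + βhat₁) = x₁ := by rw [hβhat₀, hβhat₁]; field_simp; ring
  refine ⟨fun β₀ β₁ => ⟨?_, ?_⟩, ?_⟩
  · rintro ⟨e₀, e₁⟩
    have hβ₀ : β₀ = βhat₀ := mul_left_cancel₀ hn₀.ne' (by linarith)
    have hβ : β₀ + β₁ = βhat₀ + βhat₁ := mul_left_cancel₀ hn₁.ne' (by linarith)
    exact ⟨hβ₀, by linarith⟩
  · rintro ⟨rfl, rfl⟩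
    constructor <;> linarith
  · rcases hx₁ with rfl | rfl
    · have e₀ : βhat₀ = 1 / n₀ := by simpa using hβhat₀
      have e₁ : βhat₀ + βhat₁ = 0 := by rw [hβhat₀, hβhat₁]; ring
      have hpos : 0 < βhat₀ := e₀ ▸ one_div_pos.mpr hn₀
      simp only [zero_mul, add_zero]
      refine ⟨hpos.le, e₁.ge, hpos, fun β₀ β₁ _ hβ hβ₀ => ?_⟩
      have hlog := log_sub_mul_le hn₀ hβ₀
      rw [← e₀] at hlog
      have hmul := mul_nonneg hn₁.le hβ
      linarith
    · have e₀ : βhat₀ = 0 := by simpa using hβhat₀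
      have e₁ : βhat₀ + βhat₁ = 1 / n₁ := by rw [hβhat₀, hβhat₁]; ring
      have hpos : 0 < βhat₀ + βhat₁ := e₁ ▸ one_div_pos.mpr hn₁
      simp only [one_mul]
      refine ⟨e₀.ge, hpos.le, hpos, fun β₀ β₁ hβ₀ _ hβ => ?_⟩
      have hlog := log_sub_mul_le hn₁ hβ
      rw [← e₁] at hlog
      have hmul := mul_nonneg hn₀.le hβ₀
      linarith
end
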